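/- Fix real numbers p, q, s with p, q nonzero and s > 0. The following are equivalent: (1) for every n and every n×n complex matrix K, the map (A,B) ↦ Ψ_{K,p,q,s}(A,B) is jointly concave on pairs of n×n positive definite matrices; (2) the same holds for every n and every unitary K; (3) for every n, the map (A,B) ↦ Φ_{p,q,s}(A,B) = Ψ_{𝟙,p,q,s}(A,B) is jointly concave; (4) for every n and every matrix K, the map A ↦ Ψ_{K,p,q,s}(A,A) is concave on positive definite matrices; (5) the same as (4) for every unitary K. -/

import Mathlib

open Matrix
open scoped ComplexOrder

/-- Real power of a matrix, defined via the spectral decomposition when the matrix is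
Hermitian (junk value `0` otherwise). For a positive (semi-)definite matrix this is the
usual real power given by the spectral functional calculus (with `0 ^ r = 0`). -/
noncomputable def mpow {n : ℕ} (A : Matrix (Fin n) (Fin n) ℂ) (r : ℝ) :
    Matrix (Fin n) (Fin n) ℂ :=
  if h : A.IsHermitian then
    (h.eigenvectorUnitary : Matrix (Fin n) (Fin n) ℂ) *
      Matrix.diagonal (fun i => ((h.eigenvalues i ^ r : ℝ) : ℂ)) *
      (star h.eigenvectorUnitary : Matrix (Fin n) (Fin n) ℂ)
  else 0

/-- `Ψ_{K,p,q,s}(A,B) = Tr[(A^{q/2} K* B^p K A^{q/2})^s]`. -/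
noncomputable def Psi {n : ℕ} (K : Matrix (Fin n) (Fin n) ℂ) (p q s : ℝ)
    (A B : Matrix (Fin n) (Fin n) ℂ) : ℝ :=
  (Matrix.trace (mpow (mpow A (q / 2) * Kᴴ * mpow B p * K * mpow A (q / 2)) s)).re

/-- `Φ_{p,q,s}(A,B) = Tr[(A^{q/2} B^p A^{q/2})^s]`. -/
noncomputable def Phi {n : ℕ} (p q s : ℝ) (A B : Matrix (Fin n) (Fin n) ℂ) : ℝ :=
  (Matrix.trace (mpow (mpow A (q / 2) * mpow B p * mpow A (q / 2)) s)).re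

/-- Joint concavity of a real-valued function of two positive definite matrices. -/
def JointlyConcave {n : ℕ}
    (f : Matrix (Fin n) (Fin n) ℂ → Matrix (Fin n) (Fin n) ℂ → ℝ) : Prop :=
  ∀ A₁ A₂ B₁ B₂ : Matrix (Fin n) (Fin n) ℂ,
    A₁.PosDef → A₂.PosDef → B₁.PosDef → B₂.PosDef →
    ∀ t : ℝ, 0 ≤ t → t ≤ 1 →
      t * f A₁ B₁ + (1 - t) * f A₂ B₂ ≤
        f (t • A₁ + (1 - t) • A₂) (t • B₁ + (1 - t) • B₂)

/-- Concavity of a real-valued function of one positive definite matrix. -/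
def ConcaveOnPD {n : ℕ} (f : Matrix (Fin n) (Fin n) ℂ → ℝ) : Prop :=
  ∀ A₁ A₂ : Matrix (Fin n) (Fin n) ℂ, A₁.PosDef → A₂.PosDef →
    ∀ t : ℝ, 0 ≤ t → t ≤ 1 →
      t * f A₁ + (1 - t) * f A₂ ≤ f (t • A₁ + (1 - t) • A₂)

open Polynomial

section RealPowers

variable {n : ℕ} {A : Matrix (Fin n) (Fin n) ℂ}

theorem mpow_eq_cfc (A : Matrix (Fin n) (Fin n) ℂ) (r : ℝ) :
    mpow A r = cfc (fun x : ℝ => x ^ r) A := by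
  by_cases h : A.IsHermitian
  · rw [h.cfc_eq, mpow, dif_pos h, Matrix.IsHermitian.cfc, Unitary.conjStarAlgAut_apply]
    rfl
  · rw [mpow, dif_neg h, cfc_apply_of_not_predicate (p := IsSelfAdjoint) A h]

theorem isHermitian_mpow (A : Matrix (Fin n) (Fin n) ℂ) (r : ℝ) : (mpow A r).IsHermitian := by
  rw [mpow_eq_cfc]
  exact cfc_predicate (p := IsSelfAdjoint) _ A

theorem mpow_one (r : ℝ) : mpow (1 : Matrix (Fin n) (Fin n) ℂ) r = 1 := by
  rw [mpow_eq_cfc, cfc_apply_one]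
  simp

theorem mpow_zero_of_pos {r : ℝ} (hr : 0 < r) : mpow (0 : Matrix (Fin n) (Fin n) ℂ) r = 0 := by
  rw [mpow_eq_cfc, cfc_apply_zero]
  simp [Real.zero_rpow hr.ne']

theorem spectrum_nonneg_of_posSemidef (hA : A.PosSemidef) {x : ℝ} (hx : x ∈ spectrum ℝ A) :
    0 ≤ x := by
  rw [hA.1.spectrum_real_eq_range_eigenvalues] at hx
  obtain ⟨i, rfl⟩ := hx
  exact hA.eigenvalues_nonneg i

theorem mpow_smul (hA : A.PosSemidef) {c : ℝ} (hc : 0 ≤ c) (r : ℝ) :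
    mpow (c • A) r = c ^ r • mpow A r := by
  have hA' : IsSelfAdjoint A := hA.1
  have hfin : (spectrum ℝ A).Finite := Matrix.finite_real_spectrum
  rw [mpow_eq_cfc, mpow_eq_cfc, ← cfc_comp_smul c _ A
    (((hfin.image _).continuousOn _)) hA', ← cfc_smul (c ^ r) _ A (hfin.continuousOn _)]
  refine cfc_congr fun x hx => ?_
  simp [Real.mul_rpow hc (spectrum_nonneg_of_posSemidef hA hx)]

theorem mpow_smul_one {c : ℝ} (hc : 0 ≤ c) (r : ℝ) :
    mpow (c • (1 : Matrix (Fin n) (Fin n) ℂ)) r = c ^ r • 1 := by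
  rw [mpow_smul Matrix.PosSemidef.one hc, mpow_one]

theorem posSemidef_mpow (hA : A.PosSemidef) (r : ℝ) : (mpow A r).PosSemidef := by
  rw [mpow, dif_pos hA.1, Matrix.star_eq_conjTranspose]
  refine Matrix.PosSemidef.mul_mul_conjTranspose_same (Matrix.PosSemidef.diagonal fun i => ?_) _
  have := Real.rpow_nonneg (hA.eigenvalues_nonneg i) r
  simpa using this

theorem cfc_eq_aeval (hA : A.IsHermitian) {f : ℝ → ℝ} {P : ℝ[X]}
    (h : ∀ x ∈ spectrum ℝ A, P.eval x = f x) : cfc f A = aeval A P := by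
  rw [← cfc_polynomial P A hA]
  exact cfc_congr fun x hx => (h x hx).symm

theorem exists_eval_eq_of_finite {S : Set ℝ} (hS : S.Finite) (f : ℝ → ℝ) :
    ∃ P : ℝ[X], ∀ x ∈ S, P.eval x = f x := by
  classical
  refine ⟨Lagrange.interpolate hS.toFinset id f, fun x hx => ?_⟩
  exact Lagrange.eval_interpolate_at_node (v := id) f Function.injective_id.injOn (by simpa using hx)

theorem continuousOn_mpow {s : ℝ} (hs : 0 < s) :
    ContinuousOn (fun M : Matrix (Fin n) (Fin n) ℂ => mpow M s) {M | M.IsHermitian} := by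
  simp_rw [mpow_eq_cfc]
  open scoped Matrix.Norms.L2Operator in
  exact ContinuousOn.cfc_of_mem_nhdsSet (s := Set.univ) (A := Matrix (Fin n) (Fin n) ℂ)
    (p := IsSelfAdjoint) (fun x : ℝ => x ^ s) Filter.univ_mem continuousOn_id (fun _ h => h)
    (Real.continuous_rpow_const hs.le).continuousOn

theorem mpow_conj_unitary {U : Matrix (Fin n) (Fin n) ℂ} (hU : U ∈ Matrix.unitaryGroup (Fin n) ℂ)
    (hA : A.IsHermitian) (r : ℝ) : mpow (Uᴴ * A * U) r = Uᴴ * mpow A r * U := by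
  have h1 : U * Uᴴ = 1 := Matrix.mem_unitaryGroup_iff.1 hU
  have hUA : (Uᴴ * A * U).IsHermitian := Matrix.isHermitian_conjTranspose_mul_mul U hA
  have hfin : (spectrum ℝ A ∪ spectrum ℝ (Uᴴ * A * U)).Finite :=
    Matrix.finite_real_spectrum.union Matrix.finite_real_spectrum
  obtain ⟨P, hP⟩ := exists_eval_eq_of_finite hfin (fun x => x ^ r)
  rw [mpow_eq_cfc, mpow_eq_cfc, cfc_eq_aeval hA fun x hx => hP x (.inl hx),
    cfc_eq_aeval hUA fun x hx => hP x (.inr hx)]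
  have h2 : ∀ B, Unitary.conjStarAlgAut ℝ _ (star ⟨U, hU⟩ : unitary (Matrix (Fin n) (Fin n) ℂ)) B
    = Uᴴ * B * U := fun B => by simp [Unitary.conjStarAlgAut_apply, Matrix.star_eq_conjTranspose]
  rw [← h2, ← h2]
  exact aeval_algHom_apply (Unitary.conjStarAlgAut ℝ _ _) A P

end RealPowers

section Blocks

variable {k n : ℕ}

/-- Flattening a `k × k` matrix of `n × n` blocks to a matrix of size `k * n`. -/
noncomputable def flatten (k n : ℕ) : Matrix (Fin k) (Fin k) (Matrix (Fin n) (Fin n) ℂ) ≃ₐ[ℝ]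
    Matrix (Fin (k * n)) (Fin (k * n)) ℂ :=
  (Matrix.compAlgEquiv (Fin k) (Fin n) ℂ ℝ).trans (Matrix.reindexAlgEquiv ℝ ℂ finProdFinEquiv)

theorem conjTranspose_flatten (X : Matrix (Fin k) (Fin k) (Matrix (Fin n) (Fin n) ℂ)) :
    (flatten k n X)ᴴ = flatten k n Xᴴ := by
  ext i j
  simp [flatten]

theorem trace_flatten (X : Matrix (Fin k) (Fin k) (Matrix (Fin n) (Fin n) ℂ)) :
    (flatten k n X).trace = ∑ i, (X i i).trace := by
  simp only [Matrix.trace, Matrix.diag]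
  rw [← finProdFinEquiv.sum_comp, Fintype.sum_prod_type]
  simp [flatten]

theorem continuous_flatten : Continuous (flatten k n) :=
  LinearMap.continuous_of_finiteDimensional (flatten k n).toLinearMap

/-- The block diagonal matrix with the given diagonal blocks. -/
noncomputable def flatDiag (X : Fin k → Matrix (Fin n) (Fin n) ℂ) :
    Matrix (Fin (k * n)) (Fin (k * n)) ℂ :=
  flatten k n (Matrix.diagonal X)

theorem flatDiag_isHermitian {X : Fin k → Matrix (Fin n) (Fin n) ℂ}
    (hX : ∀ i, (X i).IsHermitian) : (flatDiag X).IsHermitian := by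
  rw [Matrix.IsHermitian, flatDiag, conjTranspose_flatten, Matrix.diagonal_conjTranspose]
  congr 2
  ext1 i
  exact hX i

theorem flatDiag_posDef {X : Fin k → Matrix (Fin n) (Fin n) ℂ}
    (hX : ∀ i, (X i).PosDef) : (flatDiag X).PosDef := by
  open scoped MatrixOrder in
  choose Y hY using fun i => CStarAlgebra.nonneg_iff_eq_star_mul_self.mp (hX i).posSemidef.nonneg
  have hXY : flatDiag X = (flatDiag Y)ᴴ * flatDiag Y := by
    simp only [flatDiag, conjTranspose_flatten, ← map_mul, Matrix.diagonal_conjTranspose,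
      Matrix.diagonal_mul_diagonal]
    congr 2
    ext1 i
    exact hY i
  have hpos : (flatDiag X).PosSemidef := hXY ▸ Matrix.posSemidef_conjTranspose_mul_self _
  refine hpos.posDef_iff_isUnit.2 ?_
  have hunit : IsUnit X := Pi.isUnit_iff.2 fun i => (hX i).isUnit
  exact hunit.map ((flatten k n).toAlgHom.comp (Matrix.diagonalAlgHom ℝ))

theorem flatDiag_convex (X Y : Fin k → Matrix (Fin n) (Fin n) ℂ) (t : ℝ) :
    t • flatDiag X + (1 - t) • flatDiag Y = flatDiag (t • X + (1 - t) • Y) := by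
  simp only [flatDiag, ← map_smul, ← map_add]
  congr 1
  rw [← Matrix.diagonal_smul, ← Matrix.diagonal_smul]
  exact Matrix.diagonal_add _ _

theorem mpow_flatDiag {X : Fin k → Matrix (Fin n) (Fin n) ℂ}
    (hX : ∀ i, (X i).IsHermitian) (r : ℝ) :
    mpow (flatDiag X) r = flatDiag fun i => mpow (X i) r := by
  have hfin : ((⋃ i, spectrum ℝ (X i)) ∪ spectrum ℝ (flatDiag X)).Finite :=
    (Set.finite_iUnion fun i => Matrix.finite_real_spectrum).union Matrix.finite_real_spectrum
  obtain ⟨P, hP⟩ := exists_eval_eq_of_finite hfin (fun x => x ^ r)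
  simp_rw [mpow_eq_cfc]
  rw [cfc_eq_aeval (flatDiag_isHermitian hX) fun x hx => hP x (.inr hx)]
  have : (fun i => cfc (fun x : ℝ => x ^ r) (X i)) = aeval X P := by
    ext1 i
    rw [cfc_eq_aeval (hX i) fun x hx => hP x (.inl (Set.mem_iUnion.2 ⟨i, hx⟩))]
    exact aeval_algHom_apply (Pi.evalAlgHom ℝ _ i) X P
  rw [this]
  exact aeval_algHom_apply
    ((flatten k n).toAlgHom.comp (Matrix.diagonalAlgHom ℝ)) X P

end Blocks

section Psi

variable {k n : ℕ}

theorem Psi_one (p q s : ℝ) : Psi (1 : Matrix (Fin n) (Fin n) ℂ) p q s = Phi p q s := by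
  ext A B
  simp [Psi, Phi]

theorem posSemidef_sandwich {A B : Matrix (Fin n) (Fin n) ℂ} (hA : A.IsHermitian)
    (hB : B.PosSemidef) (K : Matrix (Fin n) (Fin n) ℂ) : (A * Kᴴ * B * K * A).PosSemidef := by
  have := hB.conjTranspose_mul_mul_same (K * A)
  rwa [Matrix.conjTranspose_mul, hA.eq, ← Matrix.mul_assoc] at this

theorem Psi_smul (K : Matrix (Fin n) (Fin n) ℂ) {c : ℝ} (p q s : ℝ)
    {A B : Matrix (Fin n) (Fin n) ℂ} (hB : B.PosSemidef) :
    Psi (c • K) p q s A B = (c * c) ^ s * Psi K p q s A B := by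
  have h : mpow A (q / 2) * (c • K)ᴴ * mpow B p * (c • K) * mpow A (q / 2)
      = (c * c) • (mpow A (q / 2) * Kᴴ * mpow B p * K * mpow A (q / 2)) := by
    simp [Matrix.conjTranspose_smul, smul_smul]
  rw [Psi, h, mpow_smul (posSemidef_sandwich (isHermitian_mpow A _) (posSemidef_mpow hB p) K)
    (mul_self_nonneg c), Matrix.trace_smul, Complex.smul_re, smul_eq_mul, Psi]

theorem Psi_unitary {U : Matrix (Fin n) (Fin n) ℂ} (hU : U ∈ Matrix.unitaryGroup (Fin n) ℂ)
    (p q s : ℝ) (A : Matrix (Fin n) (Fin n) ℂ) {B : Matrix (Fin n) (Fin n) ℂ}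
    (hB : B.IsHermitian) : Psi U p q s A B = Phi p q s A (Uᴴ * B * U) := by
  rw [Psi, Phi, mpow_conj_unitary hU hB]
  simp only [Matrix.mul_assoc]

theorem Psi_flatDiag (K : Matrix (Fin k) (Fin k) (Matrix (Fin n) (Fin n) ℂ)) (p q s : ℝ)
    {X Y : Fin k → Matrix (Fin n) (Fin n) ℂ} (hX : ∀ i, (X i).IsHermitian)
    (hY : ∀ i, (Y i).IsHermitian) :
    Psi (flatten k n K) p q s (flatDiag X) (flatDiag Y) =
      (mpow (flatten k n (Matrix.diagonal (fun i => mpow (X i) (q / 2)) * Kᴴ *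
        Matrix.diagonal (fun i => mpow (Y i) p) * K *
        Matrix.diagonal (fun i => mpow (X i) (q / 2)))) s).trace.re := by
  rw [Psi, mpow_flatDiag hX, mpow_flatDiag hY, conjTranspose_flatten]
  simp only [flatDiag, ← map_mul]

theorem posDef_smul_one {c : ℝ} (hc : 0 < c) : (c • (1 : Matrix (Fin n) (Fin n) ℂ)).PosDef :=
  Matrix.PosDef.one.smul hc

theorem posDef_convex {A B : Matrix (Fin n) (Fin n) ℂ} (hA : A.PosDef) (hB : B.PosDef) {t : ℝ}
    (h0 : 0 ≤ t) (h1 : t ≤ 1) : (t • A + (1 - t) • B).PosDef := by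
  rcases h0.eq_or_lt with rfl | h0
  · simpa using hB
  · exact (hA.smul h0).add_posSemidef (hB.posSemidef.smul (sub_nonneg.2 h1))

theorem rpow_rpow_of_mul_eq {ε a b c : ℝ} (hε : 0 ≤ ε) (h : a * b = c) : (ε ^ a) ^ b = ε ^ c := by
  rw [← Real.rpow_mul hε, h]

end Psi

section Compression

variable {n : ℕ} {p q s : ℝ}

open Filter Topology

theorem tendsto_Psi_corner (U : Matrix (Fin 2) (Fin 2) (Matrix (Fin n) (Fin n) ℂ))
    (hp : p ≠ 0) (hq : q ≠ 0) (hs : 0 < s) {A B : Matrix (Fin n) (Fin n) ℂ}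
    (hA : A.PosDef) (hB : B.PosDef) :
    Tendsto (fun ε : ℝ => Psi (flatten 2 n U) p q s (flatDiag ![A, ε ^ (2 / q) • 1])
      (flatDiag ![B, ε ^ (1 / p) • 1])) (𝓝[>] 0) (𝓝 (Psi (U 0 0) p q s A B)) := by
  set a := mpow A (q / 2) with ha
  set b := mpow B p with hb
  have ha' : aᴴ = a := isHermitian_mpow A _
  have hb' : bᴴ = b := isHermitian_mpow B _
  let D : Matrix (Fin n) (Fin n) ℂ → ℝ → Matrix (Fin 2) (Fin 2) (Matrix (Fin n) (Fin n) ℂ) :=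
    fun x ε => Matrix.diagonal ![x, ε • 1]
  let M : ℝ → Matrix (Fin (2 * n)) (Fin (2 * n)) ℂ :=
    fun ε => flatten 2 n (D a ε * Uᴴ * D b ε * U * D a ε)
  have hDc : ∀ x, Continuous (D x) := fun x => by
    refine Continuous.matrix_diagonal (continuous_pi fun i => ?_)
    fin_cases i
    · exact continuous_const
    · exact continuous_id.smul continuous_const
  have hDh : ∀ x, xᴴ = x → ∀ ε, (D x ε)ᴴ = D x ε := fun x hx ε => by
    rw [Matrix.diagonal_conjTranspose]
    congr 1
    ext1 i
    fin_cases i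
    · exact hx
    · simp
  have hMc : Continuous M :=
    continuous_flatten.comp (((((hDc a).mul continuous_const).mul (hDc b)).mul
      continuous_const).mul (hDc a))
  have hMh : ∀ ε, (M ε).IsHermitian := fun ε => by
    rw [Matrix.IsHermitian, conjTranspose_flatten]
    simp only [Matrix.conjTranspose_mul, hDh a ha', hDh b hb', Matrix.conjTranspose_conjTranspose,
      Matrix.mul_assoc, M]
  have hlim : Tendsto (fun ε => (mpow (M ε) s).trace.re) (𝓝[>] 0)
      (𝓝 (mpow (M 0) s).trace.re) := by
    have h1 : Continuous fun ε => mpow (M ε) s :=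
      (continuousOn_mpow hs).comp_continuous hMc hMh
    exact (Complex.continuous_re.comp h1.matrix_trace).continuousAt.tendsto.mono_left
      nhdsWithin_le_nhds
  have h0 : (mpow (M 0) s).trace.re = Psi (U 0 0) p q s A B := by
    have hX : ∀ i, ((![a * (U 0 0)ᴴ * b * U 0 0 * a, 0] :
        Fin 2 → Matrix (Fin n) (Fin n) ℂ) i).IsHermitian := by
      intro i
      fin_cases i
      · exact (posSemidef_sandwich ha' (posSemidef_mpow hB.posSemidef p) (U 0 0)).1
      · exact Matrix.isHermitian_zero
    have hM0 : M 0 = flatDiag ![a * (U 0 0)ᴴ * b * U 0 0 * a, 0] := by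
      simp only [M, D, flatDiag]
      congr 1
      ext1 i j
      fin_cases i <;> fin_cases j <;>
        simp [Matrix.mul_apply, Matrix.diagonal_apply, Fin.sum_univ_two,
          Matrix.star_eq_conjTranspose]
    rw [hM0, mpow_flatDiag hX, flatDiag, trace_flatten, Fin.sum_univ_two]
    simp [mpow_zero_of_pos hs, Psi, ← ha, ← hb]
  rw [← h0]
  refine hlim.congr' ?_
  filter_upwards [self_mem_nhdsWithin] with ε hε
  have hε : 0 < ε := hε
  rw [Psi_flatDiag]
  · have h1 : (fun i => mpow ((![A, ε ^ (2 / q) • 1] : Fin 2 → Matrix (Fin n) (Fin n) ℂ) i)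
        (q / 2)) = ![a, ε • 1] := by
      ext1 i
      fin_cases i
      · rfl
      · simp [mpow_smul_one (Real.rpow_nonneg hε.le _),
          rpow_rpow_of_mul_eq hε.le (div_mul_div_cancel₀ hq)]
    have h2 : (fun i => mpow ((![B, ε ^ (1 / p) • 1] : Fin 2 → Matrix (Fin n) (Fin n) ℂ) i)
        p) = ![b, ε • 1] := by
      ext1 i
      fin_cases i
      · rfl
      · simp [mpow_smul_one (Real.rpow_nonneg hε.le _),
          rpow_rpow_of_mul_eq hε.le (inv_mul_cancel₀ hp)]
    rw [h1, h2]
  · intro i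
    fin_cases i
    · exact hA.1
    · exact (posDef_smul_one (Real.rpow_pos_of_pos hε _)).1
  · intro i
    fin_cases i
    · exact hB.1
    · exact (posDef_smul_one (Real.rpow_pos_of_pos hε _)).1

theorem jointlyConcave_corner (U : Matrix (Fin 2) (Fin 2) (Matrix (Fin n) (Fin n) ℂ))
    (hp : p ≠ 0) (hq : q ≠ 0) (hs : 0 < s) (h : JointlyConcave (Psi (flatten 2 n U) p q s)) :
    JointlyConcave (Psi (U 0 0) p q s) := by
  intro A₁ A₂ B₁ B₂ hA₁ hA₂ hB₁ hB₂ t h0 h1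
  have hlim := fun {A B : Matrix (Fin n) (Fin n) ℂ} (hA : A.PosDef) (hB : B.PosDef) =>
    tendsto_Psi_corner U hp hq hs hA hB
  refine le_of_tendsto_of_tendsto (((hlim hA₁ hB₁).const_mul t).add
    ((hlim hA₂ hB₂).const_mul (1 - t)))
    (hlim (posDef_convex hA₁ hA₂ h0 h1) (posDef_convex hB₁ hB₂ h0 h1)) ?_
  filter_upwards [self_mem_nhdsWithin] with ε hε
  have hD : ∀ {A : Matrix (Fin n) (Fin n) ℂ}, A.PosDef → ∀ r : ℝ,
      (flatDiag ![A, ε ^ r • 1]).PosDef := fun hA r => by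
    refine flatDiag_posDef fun i => ?_
    fin_cases i
    · exact hA
    · exact posDef_smul_one (Real.rpow_pos_of_pos hε _)
  have hconv : ∀ (A B : Matrix (Fin n) (Fin n) ℂ) (r : ℝ),
      t • flatDiag ![A, ε ^ r • 1] + (1 - t) • flatDiag ![B, ε ^ r • 1] =
        flatDiag ![t • A + (1 - t) • B, ε ^ r • 1] := fun A B r => by
    rw [flatDiag_convex]
    congr 1
    ext1 i
    fin_cases i
    · rfl
    · simp [← add_smul]
  have := h _ _ _ _ (hD hA₁ (2 / q)) (hD hA₂ (2 / q)) (hD hB₁ (1 / p)) (hD hB₂ (1 / p)) t h0 h1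
  rwa [hconv, hconv] at this

theorem exists_unitary_dilation (K : Matrix (Fin n) (Fin n) ℂ) :
    ∃ c : ℝ, 0 < c ∧ ∃ U : Matrix (Fin 2) (Fin 2) (Matrix (Fin n) (Fin n) ℂ),
      flatten 2 n U ∈ Matrix.unitaryGroup (Fin (2 * n)) ℂ ∧ U 0 0 = c • K := by
  have hL : (Kᴴ * K).IsHermitian := Matrix.isHermitian_conjTranspose_mul_self K
  have hR : (K * Kᴴ).IsHermitian := Matrix.isHermitian_mul_conjTranspose_self K
  have hfin : (spectrum ℝ (Kᴴ * K) ∪ spectrum ℝ (K * Kᴴ)).Finite :=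
    Matrix.finite_real_spectrum.union Matrix.finite_real_spectrum
  obtain ⟨m, hm⟩ := hfin.bddAbove
  have hm1 : 0 < max m 1 := lt_max_of_lt_right one_pos
  set c : ℝ := (√(max m 1))⁻¹ with hc
  have hcc : c * c = (max m 1)⁻¹ := by
    rw [hc, ← mul_inv, Real.mul_self_sqrt hm1.le]
  obtain ⟨P, hP⟩ := exists_eval_eq_of_finite hfin (fun x => √(1 - c * c * x))
  have hPP : ∀ x ∈ spectrum ℝ (Kᴴ * K) ∪ spectrum ℝ (K * Kᴴ),
      (P * P).eval x = (1 - C (c * c) * X : ℝ[X]).eval x := fun x hx => by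
    have : 0 ≤ 1 - c * c * x := by
      rw [hcc, sub_nonneg, inv_mul_le_one₀ hm1]
      exact (hm hx).trans (le_max_left _ _)
    rw [eval_mul, hP x hx, Real.mul_self_sqrt this]
    simp
  have hsq : ∀ A : Matrix (Fin n) (Fin n) ℂ, A.IsHermitian →
      spectrum ℝ A ⊆ spectrum ℝ (Kᴴ * K) ∪ spectrum ℝ (K * Kᴴ) →
      aeval A P * aeval A P = 1 - (c * c) • A := fun A hA hS => by
    rw [← map_mul, ← cfc_eq_aeval hA (f := (P * P).eval) fun _ _ => rfl,
      cfc_eq_aeval hA fun x hx => (hPP x (hS hx)).symm]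
    simp [Algebra.smul_def]
  have hherm : ∀ A : Matrix (Fin n) (Fin n) ℂ, A.IsHermitian → (aeval A P)ᴴ = aeval A P :=
    fun A hA => by
      rw [← cfc_eq_aeval hA (f := P.eval) fun _ _ => rfl]
      exact cfc_predicate (p := IsSelfAdjoint) _ A
  have hcomm : K * aeval (Kᴴ * K) P = aeval (K * Kᴴ) P * K := by
    have : SemiconjBy K (Kᴴ * K) (K * Kᴴ) := by simp [SemiconjBy, mul_assoc]
    simp only [aeval_eq_sum_range, Finset.mul_sum, Finset.sum_mul]
    refine Finset.sum_congr rfl fun i _ => ?_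
    rw [mul_smul_comm, smul_mul_assoc, (this.pow_right i).eq]
  set d := aeval (Kᴴ * K) P
  set e := aeval (K * Kᴴ) P
  have hd : dᴴ = d := hherm _ hL
  have he : eᴴ = e := hherm _ hR
  have hcomm' : d * Kᴴ = Kᴴ * e := by
    simpa [hd, he] using congrArg Matrix.conjTranspose hcomm
  refine ⟨c, inv_pos.2 (Real.sqrt_pos.2 hm1), !![c • K, e; d, -(c • Kᴴ)], ?_, rfl⟩
  rw [Matrix.mem_unitaryGroup_iff, Matrix.star_eq_conjTranspose, conjTranspose_flatten, ← map_mul,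
    ← map_one (flatten 2 n)]
  congr 1
  have hee : e * e = 1 - (c * c) • (K * Kᴴ) := hsq _ hR Set.subset_union_right
  have hdd : d * d = 1 - (c * c) • (Kᴴ * K) := hsq _ hL Set.subset_union_left
  ext1 i j
  fin_cases i <;> fin_cases j <;>
    simp [Matrix.mul_apply, Fin.sum_univ_two, Matrix.star_eq_conjTranspose,
      Matrix.conjTranspose_smul, smul_smul, hd, he, hcomm, hcomm', hee, hdd]

end Compression

theorem jointlyConcave_Psi_of_unitary {p q s : ℝ} (hp : p ≠ 0) (hq : q ≠ 0) (hs : 0 < s)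
    (h : ∀ (n : ℕ) (K : Matrix (Fin n) (Fin n) ℂ),
      K ∈ Matrix.unitaryGroup (Fin n) ℂ → JointlyConcave (Psi K p q s))
    (n : ℕ) (K : Matrix (Fin n) (Fin n) ℂ) : JointlyConcave (Psi K p q s) := by
  obtain ⟨c, hc, U, hU, hUK⟩ := exists_unitary_dilation K
  have hcK := jointlyConcave_corner U hp hq hs (h _ _ hU)
  rw [hUK] at hcK
  intro A₁ A₂ B₁ B₂ hA₁ hA₂ hB₁ hB₂ t h0 h1
  have := hcK A₁ A₂ B₁ B₂ hA₁ hA₂ hB₁ hB₂ t h0 h1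
  rw [Psi_smul K p q s hB₁.posSemidef, Psi_smul K p q s hB₂.posSemidef,
    Psi_smul K p q s (posDef_convex hB₁ hB₂ h0 h1).posSemidef] at this
  have hpos : 0 < (c * c) ^ s := Real.rpow_pos_of_pos (mul_pos hc hc) s
  refine le_of_mul_le_mul_left ?_ hpos
  linarith

theorem jointlyConcave_Psi_of_Phi {p q s : ℝ} {n : ℕ}
    (h : JointlyConcave (Phi (n := n) p q s)) {U : Matrix (Fin n) (Fin n) ℂ}
    (hU : U ∈ Matrix.unitaryGroup (Fin n) ℂ) : JointlyConcave (Psi U p q s) := by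
  intro A₁ A₂ B₁ B₂ hA₁ hA₂ hB₁ hB₂ t h0 h1
  have hinj : Function.Injective U.mulVec :=
    Matrix.mulVec_injective_of_isUnit (Unitary.isUnit_coe (U := ⟨U, hU⟩))
  have := h A₁ A₂ _ _ hA₁ hA₂ (hB₁.conjTranspose_mul_mul_same hinj)
    (hB₂.conjTranspose_mul_mul_same hinj) t h0 h1
  rw [Psi_unitary hU p q s _ hB₁.1, Psi_unitary hU p q s _ hB₂.1,
    Psi_unitary hU p q s _ (posDef_convex hB₁ hB₂ h0 h1).1]
  simpa [Matrix.mul_add, Matrix.add_mul] using this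

section Cyclic

variable {n : ℕ} {p q s : ℝ}

/-- The block permutation matrix of the cyclic shift `j ↦ j + 1` of four blocks. -/
def cyclicShift (n : ℕ) : Matrix (Fin 4) (Fin 4) (Matrix (Fin n) (Fin n) ℂ) :=
  Matrix.of fun i j => if i = j + 1 then 1 else 0

theorem conjTranspose_cyclicShift_mul_diagonal_mul (X : Fin 4 → Matrix (Fin n) (Fin n) ℂ) :
    (cyclicShift n)ᴴ * Matrix.diagonal X * cyclicShift n =
      Matrix.diagonal fun j => X (j + 1) := by
  ext1 i j
  fin_cases i <;> fin_cases j <;>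
    simp [cyclicShift, Matrix.mul_apply, Matrix.diagonal_apply]

theorem flatten_cyclicShift_mem_unitaryGroup :
    flatten 4 n (cyclicShift n) ∈ Matrix.unitaryGroup (Fin (4 * n)) ℂ := by
  rw [Matrix.mem_unitaryGroup_iff', Matrix.star_eq_conjTranspose, conjTranspose_flatten,
    ← map_mul, ← map_one (flatten 4 n)]
  have := conjTranspose_cyclicShift_mul_diagonal_mul (n := n) fun _ => 1
  rw [Matrix.diagonal_one, mul_one] at this
  rw [this]

theorem Psi_cyclicShift {X : Fin 4 → Matrix (Fin n) (Fin n) ℂ} (hX : ∀ i, (X i).PosDef) :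
    Psi (flatten 4 n (cyclicShift n)) p q s (flatDiag X) (flatDiag X) =
      ∑ i, Phi p q s (X i) (X (i + 1)) := by
  rw [Psi_flatDiag _ _ _ _ (fun i => (hX i).1) (fun i => (hX i).1),
    Matrix.mul_assoc (Matrix.diagonal _) _ (Matrix.diagonal _),
    Matrix.mul_assoc (Matrix.diagonal _) _ (cyclicShift n),
    conjTranspose_cyclicShift_mul_diagonal_mul, Matrix.diagonal_mul_diagonal,
    Matrix.diagonal_mul_diagonal, ← flatDiag, mpow_flatDiag, flatDiag, trace_flatten,
    Complex.re_sum]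
  · simp [Phi]
  · intro i
    simpa using (posSemidef_sandwich (isHermitian_mpow (X i) (q / 2))
      (posSemidef_mpow (hX (i + 1)).posSemidef p) 1).1

theorem Phi_smul_one_right (hp : p ≠ 0) {ε : ℝ} (hε : 0 < ε) (A : Matrix (Fin n) (Fin n) ℂ) :
    Phi p q s A (ε ^ (1 / p) • 1) = ε ^ s * Phi p q s A 1 := by
  have hpos := posSemidef_sandwich (isHermitian_mpow A (q / 2)) Matrix.PosSemidef.one 1
  simp only [Matrix.conjTranspose_one, Matrix.mul_one] at hpos
  rw [Phi, mpow_smul_one (Real.rpow_nonneg hε.le _),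
    rpow_rpow_of_mul_eq hε.le (one_div_mul_cancel hp), Real.rpow_one, Phi, mpow_one]
  simp only [Matrix.mul_smul, Matrix.smul_mul, Matrix.mul_one]
  rw [mpow_smul hpos hε.le, Matrix.trace_smul, Complex.smul_re, smul_eq_mul]

theorem Phi_smul_one_left (hq : q ≠ 0) {ε : ℝ} (hε : 0 < ε) {A : Matrix (Fin n) (Fin n) ℂ}
    (hA : A.PosSemidef) : Phi p q s (ε ^ (1 / q) • 1) A = ε ^ s * Phi p q s 1 A := by
  rw [Phi, mpow_smul_one (Real.rpow_nonneg hε.le _), Phi, mpow_one]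
  simp only [Matrix.mul_smul, Matrix.smul_mul, Matrix.mul_one, Matrix.one_mul, smul_smul]
  rw [← Real.rpow_add (Real.rpow_pos_of_pos hε _), add_halves,
    rpow_rpow_of_mul_eq hε.le (one_div_mul_cancel hq), Real.rpow_one,
    mpow_smul (posSemidef_mpow hA p) hε.le, Matrix.trace_smul, Complex.smul_re, smul_eq_mul]

theorem le_of_forall_pos_le_add_mul {a b c : ℝ} (h : ∀ δ : ℝ, 0 < δ → a ≤ b + δ * c) : a ≤ b := by
  refine le_of_forall_pos_le_add fun η hη => ?_
  refine (h (η / (|c| + 1)) (by positivity)).trans ?_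
  gcongr
  rw [div_mul_eq_mul_div, div_le_iff₀ (by positivity)]
  gcongr
  linarith [le_abs_self c]

theorem jointlyConcave_Phi_of_concaveOnPD (hp : p ≠ 0) (hq : q ≠ 0) (hs : 0 < s)
    (h : ConcaveOnPD fun A => Psi (flatten 4 n (cyclicShift n)) p q s A A) :
    JointlyConcave (Phi (n := n) p q s) := by
  intro A₁ A₂ B₁ B₂ hA₁ hA₂ hB₁ hB₂ t h0 h1
  have hA := posDef_convex hA₁ hA₂ h0 h1
  have hB := posDef_convex hB₁ hB₂ h0 h1
  set A := t • A₁ + (1 - t) • A₂ with hA_def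
  set B := t • B₁ + (1 - t) • B₂ with hB_def
  let R : Matrix (Fin n) (Fin n) ℂ → Matrix (Fin n) (Fin n) ℂ → ℝ :=
    fun A B => Phi p q s B 1 + Phi p q s 1 A
  refine le_of_forall_pos_le_add_mul
    (c := R A B - t * R A₁ B₁ - (1 - t) * R A₂ B₂) fun δ hδ => ?_
  set ε := δ ^ (1 / s)
  have hε : 0 < ε := Real.rpow_pos_of_pos hδ _
  have hεs : ε ^ s = δ := by
    rw [rpow_rpow_of_mul_eq hδ.le (one_div_mul_cancel hs.ne'), Real.rpow_one]
  let Z : Matrix (Fin n) (Fin n) ℂ → Matrix (Fin n) (Fin n) ℂ →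
      Fin 4 → Matrix (Fin n) (Fin n) ℂ := fun A B => ![A, B, ε ^ (1 / p) • 1, ε ^ (1 / q) • 1]
  have hZ : ∀ {A B : Matrix (Fin n) (Fin n) ℂ}, A.PosDef → B.PosDef → ∀ i, (Z A B i).PosDef := by
    intro A B hA hB i
    fin_cases i
    · exact hA
    · exact hB
    · exact posDef_smul_one (Real.rpow_pos_of_pos hε _)
    · exact posDef_smul_one (Real.rpow_pos_of_pos hε _)
  have hval : ∀ {A B : Matrix (Fin n) (Fin n) ℂ}, A.PosDef → B.PosDef →
      Psi (flatten 4 n (cyclicShift n)) p q s (flatDiag (Z A B)) (flatDiag (Z A B)) =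
        Phi p q s A B + δ * R A B +
          Phi p q s (ε ^ (1 / p) • (1 : Matrix (Fin n) (Fin n) ℂ)) (ε ^ (1 / q) • 1) := by
    intro A B hA hB
    rw [Psi_cyclicShift (hZ hA hB), Fin.sum_univ_four]
    change Phi p q s A B + Phi p q s B (ε ^ (1 / p) • 1) +
      Phi p q s (ε ^ (1 / p) • 1) (ε ^ (1 / q) • 1) + Phi p q s (ε ^ (1 / q) • 1) A = _
    rw [Phi_smul_one_right hp hε, Phi_smul_one_left hq hε hA.posSemidef, hεs]
    ring
  have hconv : t • flatDiag (Z A₁ B₁) + (1 - t) • flatDiag (Z A₂ B₂) = flatDiag (Z A B) := by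
    rw [flatDiag_convex]
    congr 1
    ext1 i
    fin_cases i
    · rfl
    · rfl
    · simp [Z, ← add_smul]
    · simp [Z, ← add_smul]
  have key := h _ _ (flatDiag_posDef (hZ hA₁ hB₁)) (flatDiag_posDef (hZ hA₂ hB₂)) t h0 h1
  simp only [hconv, hval hA₁ hB₁, hval hA₂ hB₂, hval hA hB] at key
  linarith

end Cyclic

/-- Lemma 1.1 (equivalent formulations), concave case. -/
theorem equiv_formulations_concave (p q s : ℝ) (hp : p ≠ 0) (hq : q ≠ 0) (hs : 0 < s) :
    List.TFAE [
      ∀ (n : ℕ) (K : Matrix (Fin n) (Fin n) ℂ), JointlyConcave (Psi K p q s),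
      ∀ (n : ℕ) (K : Matrix (Fin n) (Fin n) ℂ),
        K ∈ Matrix.unitaryGroup (Fin n) ℂ → JointlyConcave (Psi K p q s),
      ∀ (n : ℕ), JointlyConcave (Phi (n := n) p q s),
      ∀ (n : ℕ) (K : Matrix (Fin n) (Fin n) ℂ), ConcaveOnPD (fun A => Psi K p q s A A),
      ∀ (n : ℕ) (K : Matrix (Fin n) (Fin n) ℂ),
        K ∈ Matrix.unitaryGroup (Fin n) ℂ → ConcaveOnPD (fun A => Psi K p q s A A)] := by
  tfae_have 1 → 2 := fun h n K _ => h n K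
  tfae_have 2 → 3 := fun h n => Psi_one (n := n) p q s ▸ h n 1 (one_mem _)
  tfae_have 3 → 2 := fun h n K hK => jointlyConcave_Psi_of_Phi (h n) hK
  tfae_have 2 → 1 := jointlyConcave_Psi_of_unitary hp hq hs
  tfae_have 1 → 4 := fun h n K A₁ A₂ hA₁ hA₂ => h n K A₁ A₂ A₁ A₂ hA₁ hA₂ hA₁ hA₂
  tfae_have 4 → 5 := fun h n K _ => h n K
  tfae_have 5 → 3 := fun h n => jointlyConcave_Phi_of_concaveOnPD hp hq hs
    (h _ _ flatten_cyclicShift_mem_unitaryGroup)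
  tfae_finish
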